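/- Let M ≥ 1 and n ≥ M be natural numbers, let h₁, …, hₙ be vectors in ℂ^M, and let P̄ ≥ 0 be a real number. Then for every subset A ⊆ {1, …, n} with |A| = M, the determinant of the M×M complex matrix I_M + P̄ · Σ_{k ∈ A} hₖ hₖ* (where hₖ hₖ* denotes the outer product of hₖ with its conjugate transpose) is a real number satisfying det(I_M + P̄ · Σ_{k ∈ A} hₖ hₖ*) ≤ (1 + P̄ · max_{1 ≤ k ≤ n} ‖hₖ‖²)^M. -/

import Mathlib

open scoped BigOperators ComplexOrder

/-- AM-GM for natural powers: the product of nonnegative reals is at most the corresponding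
power of their average. -/
theorem Real.prod_le_sum_div_card_pow {ι : Type*} [Fintype ι] [Nonempty ι] (z : ι → ℝ)
    (hz : ∀ i, 0 ≤ z i) :
    ∏ i, z i ≤ ((∑ i, z i) / Fintype.card ι) ^ Fintype.card ι := by
  have hc : Fintype.card ι ≠ 0 := Fintype.card_ne_zero
  have hmean := Real.geom_mean_le_arith_mean_weighted Finset.univ
    (fun _ : ι => (Fintype.card ι : ℝ)⁻¹) z (fun _ _ => by positivity) (by simp) fun i _ => hz i
  rw [← Finset.mul_sum, inv_mul_eq_div] at hmean
  have hpow := pow_le_pow_left₀ (Finset.prod_nonneg fun i _ => Real.rpow_nonneg (hz i) _) hmean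
    (Fintype.card ι)
  rw [← Finset.prod_pow] at hpow
  simpa only [Real.rpow_inv_natCast_pow (hz _) hc] using hpow

/-- The determinant of a positive semidefinite matrix is at most the corresponding power of the
average of its diagonal. -/
theorem Matrix.PosSemidef.re_det_le_re_trace_div_card_pow {m : Type*} [Fintype m] [DecidableEq m]
    [Nonempty m] {B : Matrix m m ℂ} (hB : B.PosSemidef) :
    B.det.re ≤ (B.trace.re / Fintype.card m) ^ Fintype.card m := by
  rw [hB.isHermitian.det_eq_prod_eigenvalues, hB.isHermitian.trace_eq_sum_eigenvalues]
  have key := Real.prod_le_sum_div_card_pow _ hB.eigenvalues_nonneg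
  simp only [Complex.coe_algebraMap, ← Complex.ofReal_prod, ← Complex.ofReal_sum,
    Complex.ofReal_re]
  exact key

/-- The trace of the outer product of a vector with its conjugate is its squared norm. -/
theorem EuclideanSpace.trace_vecMulVec_conj {m : Type*} [Fintype m] (x : EuclideanSpace ℂ m) :
    (Matrix.vecMulVec x fun i => starRingEnd ℂ (x i)).trace = ((‖x‖ ^ 2 : ℝ) : ℂ) := by
  simp [Matrix.trace_vecMulVec, dotProduct, Complex.mul_conj', EuclideanSpace.norm_sq_eq]

/-- For `M ≥ 1`, `n ≥ M`, vectors `h 1, …, h n` in `ℂ^M` and `P̄ ≥ 0`, for every subset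
`A` of the users with `|A| = M`, the determinant of `I_M + P̄ • ∑_{k ∈ A} h_k h_k*` is a
real number and satisfies `det ≤ (1 + P̄ · max_k ‖h_k‖²)^M`. -/
theorem stmt_0 (M n : ℕ) (hM : 1 ≤ M) (hn : M ≤ n)
    (h : Fin n → EuclideanSpace ℂ (Fin M)) (P : ℝ) (hP : 0 ≤ P)
    (A : Finset (Fin n)) (hA : A.card = M) :
    (((1 : Matrix (Fin M) (Fin M) ℂ) +
        (P : ℂ) • ∑ k ∈ A, Matrix.vecMulVec (h k)
          (fun i => starRingEnd ℂ (h k i))).det).im = 0 ∧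
    (((1 : Matrix (Fin M) (Fin M) ℂ) +
        (P : ℂ) • ∑ k ∈ A, Matrix.vecMulVec (h k)
          (fun i => starRingEnd ℂ (h k i))).det).re ≤
      (1 + P * (Finset.univ.sup' ⟨⟨0, by omega⟩, Finset.mem_univ _⟩
        fun k => ‖h k‖ ^ 2)) ^ M := by
  have : Nonempty (Fin M) := ⟨⟨0, hM⟩⟩
  set B := (1 : Matrix (Fin M) (Fin M) ℂ) +
    (P : ℂ) • ∑ k ∈ A, Matrix.vecMulVec (h k) (fun i => starRingEnd ℂ (h k i)) with hBdef
  set S := Finset.univ.sup' ⟨⟨0, by omega⟩, Finset.mem_univ _⟩ fun k => ‖h k‖ ^ 2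
  have hB : B.PosSemidef := by
    refine Matrix.PosSemidef.one.add (Matrix.PosSemidef.smul ?_ (by exact_mod_cast hP))
    exact Matrix.posSemidef_sum _ fun k _ => Matrix.posSemidef_vecMulVec_self_star (h k).ofLp
  have htrace : B.trace.re = M + P * ∑ k ∈ A, ‖h k‖ ^ 2 := by
    simp only [hBdef, Matrix.trace_add, Matrix.trace_one, Matrix.trace_smul, Matrix.trace_sum,
      EuclideanSpace.trace_vecMulVec_conj, Fintype.card_fin, smul_eq_mul]
    norm_cast
  have hsum : ∑ k ∈ A, ‖h k‖ ^ 2 ≤ M * S := by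
    have hle := Finset.sum_le_card_nsmul A (fun k => ‖h k‖ ^ 2) S fun k _ =>
      Finset.le_sup' (fun k => ‖h k‖ ^ 2) (Finset.mem_univ k)
    rwa [hA, nsmul_eq_mul] at hle
  have hM_pos : (0 : ℝ) < M := by exact_mod_cast hM
  refine ⟨(Complex.nonneg_iff.mp hB.det_nonneg).2.symm, ?_⟩
  have hdet := hB.re_det_le_re_trace_div_card_pow
  rw [Fintype.card_fin, htrace] at hdet
  refine hdet.trans (pow_le_pow_left₀ (by positivity) ?_ M)
  rw [div_le_iff₀ hM_pos]
  linarith [mul_le_mul_of_nonneg_left hsum hP]
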